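/- For A = ℤ[t]/(t³), the first homology of the partial complex, H₁ = ker ∂₁ / im ∂₂, is isomorphic as an abelian group to ℤ/2ℤ ⊕ ℤ/2ℤ; that is, HS₁(ℤ[t]/(t³)) ≅ ℤ/2ℤ ⊕ ℤ/2ℤ. -/

import Mathlib

open TensorProduct

set_option synthInstance.maxHeartbeats 1000000
set_option maxHeartbeats 1000000

/-- The algebra `A = ℤ[t]/(t^3)`. -/
noncomputable abbrev A : Type :=
  Polynomial ℤ ⧸ Ideal.span ({Polynomial.X ^ 3} : Set (Polynomial ℤ))

/-- If a family of elements indexed by triples of exponents satisfies the relations imposed by `∂₂`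
and vanishes as soon as one of the first two exponents is at least `3`, then it is determined by its
values at `(1, 1, 0)` and `(1, 1, 1)`, both of which are `2`-torsion. -/
lemma boundary_relations {M : Type*} [AddCommGroup M] (f : ℕ → ℕ → ℕ → M)
    (h : ∀ a b c d, f (a + b) c d + f d (c + a) b + f (b + c + a) 0 d + f d (b + c) a = 0)
    (h1 : ∀ a, f 0 a 0 = 0)
    (z1 : ∀ a b c, f (a + 3) b c = 0) (z2 : ∀ a b c, f a (b + 3) c = 0) :
    f 1 1 0 + f 1 1 0 = 0 ∧ f 1 1 1 + f 1 1 1 = 0 ∧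
      ∀ i < 3, ∀ j < 3, ∀ k < 3, f i j k =
        if (i, j, k) ∈ [(0, 1, 1), (1, 0, 1), (1, 1, 0)] then f 1 1 0
        else if (i, j, k) = (1, 1, 1) then f 1 1 1 else 0 := by
  have left_zero : ∀ a, f a 0 0 = 0 := fun a => by simpa [h1] using h 0 0 a 0
  have right_zero : ∀ a, f 0 0 a = 0 := fun a => by simpa [h1, left_zero] using h 0 a 0 0
  have zero_left : ∀ a b, f 0 a b = -f b a 0 := fun a b => by
    have := h 0 b a 0
    simp only [left_zero, zero_add, add_zero] at this
    grind
  have skew : ∀ a b, f b a 0 = -f a b 0 := fun a b => by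
    have := h a b 0 0
    simp only [left_zero, zero_left a, zero_left b, zero_add, add_zero] at this
    grind
  have zero_mid : ∀ a b, f a 0 b = f a b 0 := fun a b => by
    have := h 0 0 a b
    simp only [zero_left a b, zero_add, add_zero] at this
    grind
  have swap : ∀ a b c, f a b c = -f c b a := fun a b c => by
    have := h 0 a b c
    simp only [zero_mid, zero_add, add_zero] at this
    grind
  have add_self : ∀ a b, f a b a + f a b a = 0 := fun a b => by
    have := swap a b a
    grind
  have rel_1101 := h 1 1 0 1
  have rel_1110 := h 1 1 1 0
  have rel_1111 := h 1 1 1 1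
  have rel_1120 := h 1 1 2 0
  have rel_1201 := h 1 2 0 1
  have rel_1112 := h 1 1 1 2
  have rel_1121 := h 1 1 2 1
  have rel_1122 := h 1 1 2 2
  simp only [Nat.reduceAdd, z1, z2, zero_mid, add_zero]
    at rel_1101 rel_1110 rel_1111 rel_1120 rel_1201 rel_1112 rel_1121 rel_1122
  have := add_self 1 1
  have := add_self 1 2
  have := add_self 2 1
  have h210 : f 2 1 0 = 0 := by
    have := zero_left 2 1
    have := skew 1 2
    grind
  have h211 : f 2 1 1 = 0 := by grind
  refine ⟨by grind, by grind, fun i hi j hj k hk => ?_⟩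
  interval_cases i <;> interval_cases j <;> interval_cases k <;> simp <;> grind

/-- The class of `t` in `ℤ[t]/(t³)`. -/
noncomputable def A.t : A := Ideal.Quotient.mk _ Polynomial.X

lemma A.t_pow_add_three (n : ℕ) : A.t ^ (n + 3) = 0 := by
  rw [pow_add, A.t, ← map_pow _ _ 3,
    Ideal.Quotient.eq_zero_iff_mem.2 (Ideal.mem_span_singleton_self _), mul_zero]

lemma A.closure_t_pow : AddSubgroup.closure (Set.range fun n : ℕ => A.t ^ n) = ⊤ := by
  refine (AddSubgroup.eq_top_iff' _).2 fun a => ?_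
  obtain ⟨p, rfl⟩ := Ideal.Quotient.mk_surjective a
  induction p using Polynomial.induction_on' with
  | add p q hp hq =>
    rw [map_add]
    exact add_mem hp hq
  | monomial n c =>
    rw [← mul_one c, ← smul_eq_mul, ← Polynomial.smul_monomial, map_zsmul,
      Polynomial.monomial_one_right_eq_X_pow, map_pow]
    have pow_mem : A.t ^ n ∈ AddSubgroup.closure (Set.range fun n : ℕ => A.t ^ n) :=
      AddSubgroup.subset_closure ⟨n, rfl⟩
    exact zsmul_mem pow_mem c

lemma TensorProduct.addMonoidHom_ext {R M N P : Type*} [CommSemiring R] [AddCommMonoid M]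
    [AddCommMonoid N] [Module R M] [Module R N] [AddCommMonoid P] {f g : M ⊗[R] N →+ P}
    (h : ∀ x y, f (x ⊗ₜ y) = g (x ⊗ₜ y)) : f = g := by
  ext x
  induction x using TensorProduct.induction_on with
  | zero => rw [map_zero, map_zero]
  | add x y hx hy => rw [map_add, map_add, hx, hy]
  | tmul x y => exact h x y

lemma TensorProduct.addMonoidHom_ext_threefold {R M N P Q : Type*} [CommSemiring R]
    [AddCommMonoid M] [AddCommMonoid N] [AddCommMonoid P] [Module R M] [Module R N] [Module R P]
    [AddCommMonoid Q] {f g : M ⊗[R] (N ⊗[R] P) →+ Q}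
    (h : ∀ x y z, f (x ⊗ₜ (y ⊗ₜ z)) = g (x ⊗ₜ (y ⊗ₜ z))) : f = g :=
  addMonoidHom_ext fun x => DFunLike.congr_fun <| addMonoidHom_ext
    (f := f.comp (TensorProduct.mk R M (N ⊗[R] P) x).toAddMonoidHom)
    (g := g.comp (TensorProduct.mk R M (N ⊗[R] P) x).toAddMonoidHom) fun y z => h x y z

lemma TensorProduct.addMonoidHom_ext_fourfold {R M N P Q S : Type*} [CommSemiring R]
    [AddCommMonoid M] [AddCommMonoid N] [AddCommMonoid P] [AddCommMonoid Q] [Module R M]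
    [Module R N] [Module R P] [Module R Q] [AddCommMonoid S]
    {f g : M ⊗[R] (N ⊗[R] (P ⊗[R] Q)) →+ S}
    (h : ∀ w x y z, f (w ⊗ₜ (x ⊗ₜ (y ⊗ₜ z))) = g (w ⊗ₜ (x ⊗ₜ (y ⊗ₜ z)))) : f = g :=
  addMonoidHom_ext fun w => DFunLike.congr_fun <| addMonoidHom_ext_threefold
    (f := f.comp (TensorProduct.mk R M (N ⊗[R] (P ⊗[R] Q)) w).toAddMonoidHom)
    (g := g.comp (TensorProduct.mk R M (N ⊗[R] (P ⊗[R] Q)) w).toAddMonoidHom) fun x y z => h w x y z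

lemma TensorProduct.addMonoidHom_ext_threefold_of_closure {ι N M : Type*} [AddCommGroup N]
    [AddCommGroup M] {t : ι → N} (ht : AddSubgroup.closure (Set.range t) = ⊤)
    {f g : N ⊗[ℤ] (N ⊗[ℤ] N) →+ M}
    (h : ∀ i j k, f (t i ⊗ₜ (t j ⊗ₜ t k)) = g (t i ⊗ₜ (t j ⊗ₜ t k))) : f = g := by
  have ext_gen {f g : N →+ M} (hfg : ∀ i, f (t i) = g (t i)) : ∀ x, f x = g x :=
    DFunLike.congr_fun <| AddMonoidHom.eq_of_eqOn_dense ht <| by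
      rintro _ ⟨i, rfl⟩
      exact hfg i
  let left (y : N ⊗[ℤ] N) := ((TensorProduct.mk ℤ N (N ⊗[ℤ] N)).flip y).toAddMonoidHom
  let middle (x z : N) :=
    (TensorProduct.mk ℤ N (N ⊗[ℤ] N) x ∘ₗ (TensorProduct.mk ℤ N N).flip z).toAddMonoidHom
  let right (x y : N) :=
    (TensorProduct.mk ℤ N (N ⊗[ℤ] N) x ∘ₗ TensorProduct.mk ℤ N N y).toAddMonoidHom
  refine addMonoidHom_ext_threefold fun a b c => ?_
  refine ext_gen (f := f.comp (left (b ⊗ₜ c))) (g := g.comp (left (b ⊗ₜ c))) (fun i => ?_) a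
  refine ext_gen (f := f.comp (middle (t i) c)) (g := g.comp (middle (t i) c)) (fun j => ?_) b
  exact ext_gen (f := f.comp (right (t i) (t j))) (g := g.comp (right (t i) (t j)))
    (fun k => h i j k) c

/-- The reduction `ℤ[t]/(t³) → 𝔽₂[ε]/(ε²)`, `t ↦ ε`. -/
noncomputable def A.toDual : A →+* DualNumber (ZMod 2) :=
  Ideal.Quotient.lift _ (Polynomial.eval₂RingHom (Int.castRingHom _) DualNumber.eps) <| by
    have : (Ideal.span {(Polynomial.X : Polynomial ℤ) ^ 3}) ≤
        RingHom.ker (Polynomial.eval₂RingHom (Int.castRingHom (DualNumber (ZMod 2)))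
          DualNumber.eps) := by
      rw [Ideal.span_singleton_le_iff_mem, RingHom.mem_ker]
      simp [pow_succ]
    exact fun a ha => this ha

@[simp]
lemma A.toDual_t : A.toDual A.t = DualNumber.eps := by
  exact Polynomial.eval₂_X _ _

/-- The constant coefficient modulo `2`. -/
noncomputable def A.coeffZero : A →ₗ[ℤ] ZMod 2 :=
  ((TrivSqZeroExt.fstHom ℤ (ZMod 2) (ZMod 2)).toRingHom.comp A.toDual).toAddMonoidHom.toIntLinearMap

/-- The coefficient of `t` modulo `2`. -/
noncomputable def A.coeffOne : A →ₗ[ℤ] ZMod 2 :=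
  ((TrivSqZeroExt.sndHom (ZMod 2) (ZMod 2)).toAddMonoidHom.comp
    A.toDual.toAddMonoidHom).toIntLinearMap

lemma A.coeffZero_apply (a : A) : A.coeffZero a = (A.toDual a).fst := rfl

lemma A.coeffOne_apply (a : A) : A.coeffOne a = (A.toDual a).snd := rfl

lemma A.coeffZero_one : A.coeffZero 1 = 1 := by simp [A.coeffZero_apply]

lemma A.coeffOne_one : A.coeffOne 1 = 0 := by simp [A.coeffOne_apply]

lemma A.coeffZero_t : A.coeffZero A.t = 0 := by simp [A.coeffZero_apply]

lemma A.coeffOne_t : A.coeffOne A.t = 1 := by simp [A.coeffOne_apply]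

lemma A.coeffZero_mul (a b : A) : A.coeffZero (a * b) = A.coeffZero a * A.coeffZero b := by
  simp [A.coeffZero_apply]

lemma A.coeffOne_mul (a b : A) :
    A.coeffOne (a * b) = A.coeffZero a * A.coeffOne b + A.coeffOne a * A.coeffZero b := by
  simp [A.coeffOne_apply, A.coeffZero_apply]

section TripleMul

variable {R M S : Type*} [CommSemiring R] [AddCommMonoid M] [Module R M] [CommSemiring S]
  [Algebra R S]

/-- The product of three functionals as a functional on the triple tensor product. -/
noncomputable def tripleMul (f g h : M →ₗ[R] S) : M ⊗[R] (M ⊗[R] M) →ₗ[R] S :=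
  LinearMap.mul' R S ∘ₗ TensorProduct.map f (LinearMap.mul' R S ∘ₗ TensorProduct.map g h)

lemma tripleMul_tmul (f g h : M →ₗ[R] S) (a b c : M) :
    tripleMul f g h (a ⊗ₜ (b ⊗ₜ c)) = f a * (g b * h c) := by
  simp [tripleMul]

end TripleMul

open A in
/-- The pair of functionals detecting the classes of `t ⊗ t ⊗ 1` and `t ⊗ t ⊗ t`. -/
noncomputable def detect : A ⊗[ℤ] (A ⊗[ℤ] A) →ₗ[ℤ] ZMod 2 × ZMod 2 :=
  ((tripleMul coeffZero coeffOne coeffOne + tripleMul coeffOne coeffZero coeffOne +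
    tripleMul coeffOne coeffOne coeffZero).prod
      (tripleMul coeffOne coeffOne coeffOne)).toAddMonoidHom.toIntLinearMap

open A in
lemma detect_tmul (a b c : A) : detect (a ⊗ₜ (b ⊗ₜ c)) =
    (coeffZero a * (coeffOne b * coeffOne c) + coeffOne a * (coeffZero b * coeffOne c) +
      coeffOne a * (coeffOne b * coeffZero c), coeffOne a * (coeffOne b * coeffOne c)) := by
  refine Prod.ext ?_ (tripleMul_tmul ..)
  rw [← tripleMul_tmul, ← tripleMul_tmul, ← tripleMul_tmul]
  rfl

lemma detect_relation (a b c d : A) :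
    detect ((a * b) ⊗ₜ[ℤ] (c ⊗ₜ[ℤ] d) + d ⊗ₜ[ℤ] ((c * a) ⊗ₜ[ℤ] b) +
      (b * c * a) ⊗ₜ[ℤ] ((1 : A) ⊗ₜ[ℤ] d) + d ⊗ₜ[ℤ] ((b * c) ⊗ₜ[ℤ] a)) = 0 := by
  simp only [map_add, detect_tmul, A.coeffZero_mul, A.coeffOne_mul, A.coeffZero_one, A.coeffOne_one]
  generalize A.coeffZero a = a₀, A.coeffOne a = a₁, A.coeffZero b = b₀, A.coeffOne b = b₁,
    A.coeffZero c = c₀, A.coeffOne c = c₁, A.coeffZero d = d₀, A.coeffOne d = d₁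
  refine Prod.ext ?_ ?_
  · revert a₀ a₁ b₀ b₁ c₀ c₁ d₀ d₁
    decide
  · revert a₀ a₁ b₀ b₁ c₀ c₁ d₀ d₁
    decide

lemma detect_t_t_one : detect (A.t ⊗ₜ (A.t ⊗ₜ 1)) = (1, 0) := by
  simp [detect_tmul, A.coeffZero_one, A.coeffOne_one, A.coeffZero_t, A.coeffOne_t]

lemma detect_t_t_t : detect (A.t ⊗ₜ (A.t ⊗ₜ A.t)) = (0, 1) := by
  simp [detect_tmul, A.coeffZero_t, A.coeffOne_t]

lemma detect_t_pow (i j k : ℕ) : detect ((A.t ^ i) ⊗ₜ ((A.t ^ j) ⊗ₜ (A.t ^ k))) =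
    if (i, j, k) ∈ [(0, 1, 1), (1, 0, 1), (1, 1, 0)] then (1, 0)
    else if (i, j, k) = (1, 1, 1) then (0, 1) else 0 := by
  have zero : ∀ n, A.coeffZero (A.t ^ n) = if n = 0 then 1 else 0 := by
    rintro (_ | n)
    · simp [A.coeffZero_one]
    · simp [pow_succ, A.coeffZero_mul, A.coeffZero_t]
  have one : ∀ n, A.coeffOne (A.t ^ n) = if n = 1 then 1 else 0 := by
    rintro (_ | n)
    · simp [A.coeffOne_one]
    · simp [pow_succ, A.coeffOne_mul, A.coeffZero_t, A.coeffOne_t, zero]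
  simp only [detect_tmul, zero, one]
  rcases i with _ | _ | i <;> rcases j with _ | _ | j <;> rcases k with _ | _ | k <;> simp

/-- The homomorphism from `ℤ/2 × ℤ/2` determined by two elements of order dividing `2`. -/
noncomputable def ofTwoTorsion {M : Type*} [AddCommGroup M] (x y : M) (hx : x + x = 0)
    (hy : y + y = 0) : ZMod 2 × ZMod 2 →+ M :=
  (ZMod.lift 2 ⟨zmultiplesHom M x, by simpa [two_zsmul] using hx⟩).coprod
    (ZMod.lift 2 ⟨zmultiplesHom M y, by simpa [two_zsmul] using hy⟩)

lemma ofTwoTorsion_one_zero {M : Type*} [AddCommGroup M] (x y : M) (hx : x + x = 0)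
    (hy : y + y = 0) : ofTwoTorsion x y hx hy (1, 0) = x := by
  have := ZMod.lift_coe 2 ⟨zmultiplesHom M x, by simpa [two_zsmul] using hx⟩ 1
  simpa [ofTwoTorsion] using this

lemma ofTwoTorsion_zero_one {M : Type*} [AddCommGroup M] (x y : M) (hx : x + x = 0)
    (hy : y + y = 0) : ofTwoTorsion x y hx hy (0, 1) = y := by
  have := ZMod.lift_coe 2 ⟨zmultiplesHom M y, by simpa [two_zsmul] using hy⟩ 1
  simpa [ofTwoTorsion] using this

/-- HS₁(ℤ[t]/(t³)) ≅ ℤ/2ℤ ⊕ ℤ/2ℤ: the first homology `ker ∂₁ / im ∂₂` of the partial complex is isomorphic as an abelian group to `ℤ/2ℤ ⊕ ℤ/2ℤ`. -/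
theorem HS1_int_t_cube
    (d₁ : A ⊗[ℤ] (A ⊗[ℤ] A) →ₗ[ℤ] A)
    (d₂ : ((A ⊗[ℤ] (A ⊗[ℤ] (A ⊗[ℤ] A))) × A) →ₗ[ℤ] A ⊗[ℤ] (A ⊗[ℤ] A))
    (h₁ : ∀ a b c : A, d₁ (a ⊗ₜ[ℤ] (b ⊗ₜ[ℤ] c)) = a * b * c - c * b * a)
    (h₂ : ∀ a b c d : A, d₂ (a ⊗ₜ[ℤ] (b ⊗ₜ[ℤ] (c ⊗ₜ[ℤ] d)), 0) =
      (a * b) ⊗ₜ[ℤ] (c ⊗ₜ[ℤ] d) + d ⊗ₜ[ℤ] ((c * a) ⊗ₜ[ℤ] b) +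
        (b * c * a) ⊗ₜ[ℤ] ((1 : A) ⊗ₜ[ℤ] d) + d ⊗ₜ[ℤ] ((b * c) ⊗ₜ[ℤ] a))
    (h₃ : ∀ a : A, d₂ (0, a) = (1 : A) ⊗ₜ[ℤ] (a ⊗ₜ[ℤ] (1 : A))) :
    Nonempty
      ((↥(LinearMap.ker d₁) ⧸
          Submodule.comap (LinearMap.ker d₁).subtype (LinearMap.range d₂)) ≃+
        (ZMod 2 × ZMod 2)) := by
  have hd₁ : d₁ = 0 := LinearMap.toAddMonoidHom_injective <|
    TensorProduct.addMonoidHom_ext_threefold fun a b c => by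
      refine (h₁ a b c).trans ?_
      rw [mul_right_comm, mul_comm a, mul_right_comm, sub_self]
      rfl
  have detect_left : ∀ x, detect (d₂ (x, 0)) = 0 := fun x => by
    refine DFunLike.congr_fun (TensorProduct.addMonoidHom_ext_fourfold (f := detect.toAddMonoidHom.comp
      (d₂.toAddMonoidHom.comp (AddMonoidHom.inl _ _))) (g := 0) fun a b c d => ?_) x
    exact (congrArg detect (h₂ a b c d)).trans (detect_relation a b c d)
  have detect_right : ∀ a, detect (d₂ (0, a)) = 0 := fun a => by
    rw [h₃, detect_tmul]
    simp [A.coeffOne_one]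
  have range_le : LinearMap.range d₂ ≤ LinearMap.ker detect := by
    rintro _ ⟨⟨x, a⟩, rfl⟩
    have split : ((x, a) : (A ⊗[ℤ] (A ⊗[ℤ] (A ⊗[ℤ] A))) × A) = (x, 0) + (0, a) := by simp
    rw [LinearMap.mem_ker, split, map_add, map_add, detect_left, detect_right, add_zero]
  let π := (LinearMap.range d₂).mkQ
  have hπ : ∀ x, π (d₂ x) = 0 := fun x =>
    (Submodule.Quotient.mk_eq_zero _).2 (LinearMap.mem_range_self d₂ x)
  obtain ⟨two, three, values⟩ :=
    boundary_relations (fun i j k => π ((A.t ^ i) ⊗ₜ ((A.t ^ j) ⊗ₜ (A.t ^ k))))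
      (fun a b c d => by
        have := hπ ((A.t ^ a) ⊗ₜ ((A.t ^ b) ⊗ₜ ((A.t ^ c) ⊗ₜ (A.t ^ d))), 0)
        rw [h₂] at this
        simpa only [← pow_add, map_add, pow_zero] using this)
      (fun a => by
        have := hπ (0, A.t ^ a)
        rw [h₃] at this
        simpa only [pow_zero] using this)
      (by simp [A.t_pow_add_three]) (by simp [A.t_pow_add_three])
  have factor : (ofTwoTorsion _ _ two three).toIntLinearMap ∘ₗ detect = π := by
    refine LinearMap.toAddMonoidHom_injective <|
      TensorProduct.addMonoidHom_ext_threefold_of_closure A.closure_t_pow fun i j k => ?_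
    change ofTwoTorsion _ _ two three (detect _) = π _
    rw [detect_t_pow]
    by_cases hijk : i < 3 ∧ j < 3 ∧ k < 3
    · rw [values i hijk.1 j hijk.2.1 k hijk.2.2]
      split_ifs
      · exact ofTwoTorsion_one_zero ..
      · exact ofTwoTorsion_zero_one ..
      · exact map_zero _
    · have vanish : (A.t ^ i) ⊗ₜ[ℤ] ((A.t ^ j) ⊗ₜ[ℤ] (A.t ^ k)) = 0 := by
        have pow_eq_zero : ∀ n, 3 ≤ n → (A.t ^ n) = 0 := fun n hn => by
          rw [← Nat.sub_add_cancel hn, A.t_pow_add_three]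
        rcases (by omega : 3 ≤ i ∨ 3 ≤ j ∨ 3 ≤ k) with h | h | h <;> simp [pow_eq_zero _ h]
      rw [← detect_t_pow, vanish]
      simp only [map_zero]
  have ker_eq : LinearMap.ker detect = LinearMap.range d₂ := by
    refine le_antisymm (fun x hx => ?_) range_le
    rw [← Submodule.Quotient.mk_eq_zero, ← Submodule.mkQ_apply]
    change π x = 0
    rw [← factor, LinearMap.comp_apply, LinearMap.mem_ker.1 hx, map_zero]
  have surj : Function.Surjective (detect ∘ₗ (LinearMap.ker d₁).subtype) := by
    rw [← LinearMap.range_eq_top, LinearMap.range_comp, Submodule.range_subtype, hd₁,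
      LinearMap.ker_zero, Submodule.map_top, LinearMap.range_eq_top]
    rintro ⟨u, v⟩
    refine ⟨(u.val : ℤ) • (A.t ⊗ₜ (A.t ⊗ₜ 1)) + (v.val : ℤ) • (A.t ⊗ₜ (A.t ⊗ₜ A.t)), ?_⟩
    simp [map_add, detect_t_t_one, detect_t_t_t]
  have ker_comp : Submodule.comap (LinearMap.ker d₁).subtype (LinearMap.range d₂) =
      LinearMap.ker (detect ∘ₗ (LinearMap.ker d₁).subtype) := by
    rw [LinearMap.ker_comp, ker_eq]
  exact ⟨((Submodule.quotEquivOfEq _ _ ker_comp).trans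
    (LinearMap.quotKerEquivOfSurjective _ surj)).toAddEquiv⟩
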